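/- arXiv:1209.4545 — 5 statements merged into one kernel-verified Lean document; each statement's English description precedes it below -/
import Mathlib

section
/- Let I : ℕ → Finset ℕ be a family of finite subsets of ℕ. Suppose that for every natural number N there exists a finite subset F of ℕ with |F| ≥ |⋃_{j∈F} I_j| + N. Then for every finite subset G of ℕ there exists a finite subset H of ℕ with H ∩ G = ∅ and |H| ≥ |⋃_{j∈H} I_j| + 1. -/
/-- Claim inside the proof of Lemma 4.1: if for every `N` there is a finite `F` with
`|F| ≥ |⋃_{j∈F} I_j| + N`, then for every finite `G` there is a finite `H` disjoint
from `G` with `|H| ≥ |⋃_{j∈H} I_j| + 1`. -/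
theorem stmt_6 (I : ℕ → Finset ℕ)
    (h : ∀ N : ℕ, ∃ F : Finset ℕ, (F.biUnion I).card + N ≤ F.card)
    (G : Finset ℕ) :
    ∃ H : Finset ℕ, H ∩ G = ∅ ∧ ((H.biUnion I).card + 1 ≤ H.card) := by
  obtain ⟨F, hF⟩ := h (G.card + 1)
  refine ⟨F \ G, Finset.sdiff_inter_self G F, ?_⟩
  have hU : ((F \ G).biUnion I).card ≤ (F.biUnion I).card :=
    Finset.card_le_card (Finset.biUnion_subset_biUnion_of_subset_left I Finset.sdiff_subset)
  have hcard : F.card - G.card ≤ (F \ G).card := Finset.le_card_sdiff G F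
  omega
end

section
/- Let I : ℕ → Finset ℕ be a family of finite subsets of ℕ. Suppose that for every natural number N there exists a finite subset F of ℕ with |F| ≥ |⋃_{j∈F} I_j| + N. Then there exists a sequence (H_i)_{i∈ℕ} of pairwise disjoint finite subsets of ℕ such that |H_i| ≥ |⋃_{j∈H_i} I_j| + 1 for every i. -/
/-- If every finite set `U` is disjoint from some finite set satisfying `P`, then there is a
sequence of pairwise disjoint finite sets satisfying `P`. -/
theorem Finset.exists_seq_pairwise_disjoint {α : Type*} [DecidableEq α] {P : Finset α → Prop}
    (h : ∀ U : Finset α, ∃ G : Finset α, Disjoint U G ∧ P G) :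
    ∃ H : ℕ → Finset α, (∀ i j, i ≠ j → Disjoint (H i) (H j)) ∧ ∀ i, P (H i) := by
  choose g hdisj hP using h
  let U : ℕ → Finset α := fun n => Nat.rec ∅ (fun _ V => V ∪ g V) n
  have hU : Monotone U := monotone_nat_of_le_succ fun _ => Finset.subset_union_left
  have hlt : ∀ i j, i < j → Disjoint (g (U i)) (g (U j)) := fun i j hij =>
    (hdisj (U j)).mono_left <|
      (Finset.subset_union_right : g (U i) ⊆ U i ∪ g (U i)).trans (hU (Nat.succ_le_of_lt hij))
  refine ⟨fun n => g (U n), fun i j hij => ?_, fun i => hP _⟩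
  rcases lt_or_gt_of_ne hij with hij | hij
  · exact hlt i j hij
  · exact (hlt j i hij).symm

/-- The iterative construction in the proof of Lemma 4.1: if for every `N` there is a finite
`F` with `|F| ≥ |⋃_{j∈F} I_j| + N`, then there is a sequence of pairwise disjoint finite sets
`H i` with `|H i| ≥ |⋃_{j∈H i} I_j| + 1` for every `i`. -/
theorem stmt_7 (I : ℕ → Finset ℕ)
    (h : ∀ N : ℕ, ∃ F : Finset ℕ, (F.biUnion I).card + N ≤ F.card) :
    ∃ H : ℕ → Finset ℕ, (∀ i j, i ≠ j → Disjoint (H i) (H j)) ∧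
      ∀ i, ((H i).biUnion I).card + 1 ≤ (H i).card := by
  refine Finset.exists_seq_pairwise_disjoint
    (P := fun G : Finset ℕ => (G.biUnion I).card + 1 ≤ G.card) fun U => ?_
  obtain ⟨F, hF⟩ := h (U.card + 1)
  refine ⟨F \ U, Finset.disjoint_sdiff, ?_⟩
  have hI : ((F \ U).biUnion I).card ≤ (F.biUnion I).card :=
    Finset.card_le_card (Finset.biUnion_subset_biUnion_of_subset_left I Finset.sdiff_subset)
  have hcard : F.card - U.card ≤ (F \ U).card := Finset.le_card_sdiff U F
  omega
end

section
/- Let I : ℕ → Finset ℕ be a family of finite subsets of ℕ and let k be a natural number. Assume |F| ≤ |⋃_{s∈F} I_s| + k for every finite subset F of ℕ, and suppose F₀ is a finite subset of ℕ with |F₀| = |⋃_{s∈F₀} I_s| + k. Let B be a finite subset of ℕ with |B| = k and B ∩ I_s = ∅ for every s ∈ ℕ. Then there exists an injective map t : ℕ → ℕ such that t(s) ∈ I_s ∪ B for every s ∈ ℕ, and moreover t(s) ∈ I_s whenever s ∉ F₀. -/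
/-- Refined Hall argument (Theorem 5.4): with hypotheses as in the compensated Hall condition
and `F₀` a finite set achieving the deficiency `k` exactly, there is an injective system of
distinct representatives `t` for `(I s ∪ B)` with `t s ∈ I s` whenever `s ∉ F₀`. -/
theorem stmt_9 (I : ℕ → Finset ℕ) (k : ℕ)
    (h : ∀ F : Finset ℕ, F.card ≤ (F.biUnion I).card + k)
    (F₀ : Finset ℕ) (hF₀ : F₀.card = (F₀.biUnion I).card + k)
    (B : Finset ℕ) (hBcard : B.card = k) (hBdisj : ∀ s, Disjoint B (I s)) :
    ∃ t : ℕ → ℕ, Function.Injective t ∧ (∀ s, t s ∈ I s ∪ B) ∧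
      ∀ s, s ∉ F₀ → t s ∈ I s := by
  have union_disj : ∀ F : Finset ℕ, Disjoint (F.biUnion I) B := fun F =>
    (Finset.disjoint_biUnion_left F I B).2 fun s _ => (hBdisj s).symm
  have hall : ∀ F : Finset ℕ, F.card ≤ (F.biUnion fun s => I s ∪ B).card := by
    intro F
    rcases F.eq_empty_or_nonempty with rfl | ⟨a, ha⟩
    · simp
    · have hsub : F.biUnion I ∪ B ⊆ F.biUnion fun s => I s ∪ B := by
        intro x hx
        simp only [Finset.mem_union, Finset.mem_biUnion] at hx ⊢
        rcases hx with ⟨s, hs, hxs⟩ | hx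
        · exact ⟨s, hs, Or.inl hxs⟩
        · exact ⟨a, ha, Or.inr hx⟩
      have hle := Finset.card_le_card hsub
      rw [Finset.card_union_of_disjoint (union_disj F), hBcard] at hle
      exact (h F).trans hle
  obtain ⟨t, ht_inj, ht⟩ :=
    (Finset.all_card_le_biUnion_card_iff_exists_injective fun s => I s ∪ B).1 hall
  refine ⟨t, ht_inj, ht, fun s hs => ?_⟩
  -- By cardinality, `t` maps `F₀` onto `F₀.biUnion I ∪ B`, so it uses up all of `B` there.
  have himage : F₀.image t = F₀.biUnion I ∪ B := by
    apply Finset.eq_of_subset_of_card_le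
    · intro x hx
      obtain ⟨a, ha, rfl⟩ := Finset.mem_image.1 hx
      exact Finset.union_subset_union_left (Finset.subset_biUnion_of_mem I ha) (ht a)
    · rw [Finset.card_image_of_injective _ ht_inj,
        Finset.card_union_of_disjoint (union_disj F₀), hBcard, hF₀]
  refine (Finset.mem_union.1 (ht s)).resolve_right fun hB => hs ?_
  have hmem : t s ∈ F₀.image t := himage ▸ Finset.mem_union_right _ hB
  exact (ht_inj.mem_finset_image).1 hmem
end

section
/- Let k be a natural number and let I : ℕ → Finset ℕ satisfy |F| ≤ |⋃_{s∈F} I_s| + k for every finite subset F of ℕ. Let ν : ℤ × ℕ → ℕ be injective, and let B : ℤ → Finset ℕ be a family of pairwise disjoint finite subsets of ℕ with |B_j| = k for every j ∈ ℤ and with each B_j disjoint from the range of ν. Then there exists an injective map t : ℤ × ℕ → ℕ such that t(j,s) ∈ {ν(j,x) : x ∈ I_s} ∪ B_j for every (j,s) ∈ ℤ × ℕ. -/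
/-- Hall's marriage theorem with deficiency: if the family `I` violates Hall's condition by at most
`k`, then adjoining `k` new elements `B` to (an injective copy of) every member of the family
yields a family with a system of distinct representatives. -/
theorem exists_injective_mem_image_union_of_card_le_add {ι α β : Type*}
    [DecidableEq α] [DecidableEq β] {k : ℕ} {I : ι → Finset α}
    (h : ∀ F : Finset ι, F.card ≤ (F.biUnion I).card + k)
    {g : α → β} (hg : Function.Injective g) {B : Finset β} (hB : B.card = k)
    (hgB : ∀ x, g x ∉ B) :
    ∃ f : ι → β, Function.Injective f ∧ ∀ s, f s ∈ (I s).image g ∪ B := by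
  refine (Finset.all_card_le_biUnion_card_iff_exists_injective fun s => (I s).image g ∪ B).mp
    fun F => ?_
  obtain rfl | ⟨s₀, hs₀⟩ := F.eq_empty_or_nonempty
  · simp
  have hdisj : Disjoint ((F.biUnion I).image g) B := by
    rw [Finset.disjoint_left]
    intro y hy
    obtain ⟨x, -, rfl⟩ := Finset.mem_image.mp hy
    exact hgB x
  calc F.card ≤ (F.biUnion I).card + k := h F
    _ = ((F.biUnion I).image g ∪ B).card := by
      rw [Finset.card_union_of_disjoint hdisj, Finset.card_image_of_injective _ hg, hB]
    _ ≤ (F.biUnion fun s => (I s).image g ∪ B).card := by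
      refine Finset.card_le_card (Finset.union_subset ?_ ?_)
      · rw [Finset.biUnion_image]
        exact Finset.biUnion_mono fun s _ => Finset.subset_union_left
      · exact Finset.subset_union_right.trans
          (Finset.subset_biUnion_of_mem (fun s => (I s).image g ∪ B) hs₀)

/-- Construction of the injective map `t₁` on `Γ₁` in the proof of Theorem 5.4: given the
deficiency-`k` condition on `(I s)`, an injective `ν : ℤ × ℕ → ℕ`, and pairwise disjoint sets
`B j` of cardinality `k` disjoint from the range of `ν`, there is an injective
`t : ℤ × ℕ → ℕ` with `t (j,s) ∈ ν(j, I s) ∪ B j` for all `(j,s)`. -/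
theorem stmt_10 (k : ℕ) (I : ℕ → Finset ℕ)
    (h : ∀ F : Finset ℕ, F.card ≤ (F.biUnion I).card + k)
    (ν : ℤ × ℕ → ℕ) (hν : Function.Injective ν)
    (B : ℤ → Finset ℕ)
    (hBdisj : ∀ j j', j ≠ j' → Disjoint (B j) (B j'))
    (hBcard : ∀ j, (B j).card = k)
    (hBν : ∀ (j : ℤ) (x : ℤ × ℕ), ν x ∉ B j) :
    ∃ t : ℤ × ℕ → ℕ, Function.Injective t ∧
      ∀ js : ℤ × ℕ, t js ∈ ((I js.2).image fun x => ν (js.1, x)) ∪ B js.1 := by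
  choose f hf hfmem using fun j : ℤ =>
    exists_injective_mem_image_union_of_card_le_add h
      (hν.comp (Prod.mk_right_injective j)) (hBcard j) fun x => hBν j (j, x)
  refine ⟨fun js => f js.1 js.2, ?_, fun js => hfmem js.1 js.2⟩
  rintro ⟨j, s⟩ ⟨j', s'⟩ heq
  change f j s = f j' s' at heq
  obtain rfl : j = j' := by
    by_contra hne
    have h₁ := hfmem j s
    have h₂ := hfmem j' s'
    rw [← heq] at h₂
    simp only [Finset.mem_union, Finset.mem_image, Function.comp_apply] at h₁ h₂
    rcases h₁ with ⟨x, -, hx⟩ | h₁ <;> rcases h₂ with ⟨y, -, hy⟩ | h₂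
    · exact hne (congrArg Prod.fst (hν (hx.trans hy.symm)))
    · exact hBν j' _ (hx ▸ h₂)
    · exact hBν j _ (hy ▸ h₁)
    · exact Finset.disjoint_left.mp (hBdisj j j' hne) h₁ h₂
  rw [hf j heq]
end

section
/- Let k be a natural number, let I : ℕ → Finset ℕ satisfy |F| ≤ |⋃_{s∈F} I_s| + k for every finite subset F of ℕ, let ν : ℤ × ℕ → ℕ be injective, and let B : ℤ → Finset ℕ be pairwise disjoint finite subsets of ℕ with |B_j| = k for every j ∈ ℤ and each B_j disjoint from the range of ν. Define B̃_j = B_j ∪ {ν(j,1), ν(j,2), …, ν(j,j)} for j ≥ 1 and B̃_j = B_j for j ≤ 0. Define recursively families of finite subsets of ℕ: f₀ indexed by ℕ with f₀(s) = I_s, and f_{m+1} indexed by ℤ × (index set of f_m) with f_{m+1}(j, λ) = {ν(j,x) : x ∈ f_m(λ)} ∪ B̃_j. Then for every m ≥ 1 there exists an injective map t from the index set ℤ^m × ℕ of f_m to ℕ such that t(λ) ∈ f_m(λ) for every index λ. -/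
/-- `B̃ j = B j ∪ {ν(j,1), …, ν(j,j)}` for `j ≥ 1`, and `B̃ j = B j` for `j ≤ 0`. -/
def Btilde (ν : ℤ × ℕ → ℕ) (B : ℤ → Finset ℕ) (j : ℤ) : Finset ℕ :=
  B j ∪ (Finset.Icc 1 j.toNat).image fun x => ν (j, x)

/-- The recursively defined families of finite subsets of `ℕ`:
`f 0` is indexed by `ℕ` with `f 0 s = I s`, and `f (m+1)` is indexed by
`ℤ × (index set of f m)` (realized as `(Fin (m+1) → ℤ) × ℕ`) with
`f (m+1) (j, λ) = ν(j, f m λ) ∪ B̃ j`. -/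
def fam (ν : ℤ × ℕ → ℕ) (B : ℤ → Finset ℕ) (I : ℕ → Finset ℕ) :
    (m : ℕ) → (Fin m → ℤ) × ℕ → Finset ℕ
  | 0, idx => I idx.2
  | m + 1, idx =>
      ((fam ν B I m (fun i => idx.1 i.succ, idx.2)).image fun x => ν (idx.1 0, x)) ∪
        Btilde ν B (idx.1 0)

/-- A family of finite sets satisfying Hall's condition up to a deficiency of `k` has an injective
system of distinct representatives once its disjoint injective copy is enlarged by a fixed set of
cardinality `k`. -/
theorem exists_injective_mem_image_union_of_deficiency {ι α β : Type*} [DecidableEq α]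
    [DecidableEq β] {k : ℕ} {I : ι → Finset α}
    (hI : ∀ F : Finset ι, F.card ≤ (F.biUnion I).card + k)
    {g : α → β} (hg : Function.Injective g) {C : Finset β} (hC : C.card = k)
    (hgC : ∀ a, g a ∉ C) :
    ∃ t : ι → β, Function.Injective t ∧ ∀ s, t s ∈ (I s).image g ∪ C := by
  refine (Finset.all_card_le_biUnion_card_iff_exists_injective _).1 fun F => ?_
  obtain rfl | ⟨s₀, hs₀⟩ := F.eq_empty_or_nonempty
  · simp
  have hdisj : Disjoint ((F.biUnion I).image g) C := by
    rw [Finset.disjoint_left]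
    intro x hx
    obtain ⟨a, -, rfl⟩ := Finset.mem_image.1 hx
    exact hgC a
  calc F.card ≤ (F.biUnion I).card + k := hI F
    _ = ((F.biUnion I).image g ∪ C).card := by
      rw [Finset.card_union_of_disjoint hdisj, Finset.card_image_of_injective _ hg, hC]
    _ ≤ (F.biUnion fun s => (I s).image g ∪ C).card := by
      refine Finset.card_le_card fun x hx => ?_
      rw [Finset.mem_biUnion]
      obtain hx | hx := Finset.mem_union.1 hx
      · obtain ⟨a, ha, rfl⟩ := Finset.mem_image.1 hx
        obtain ⟨s, hs, has⟩ := Finset.mem_biUnion.1 ha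
        exact ⟨s, hs, Finset.mem_union_left _ (Finset.mem_image_of_mem _ has)⟩
      · exact ⟨s₀, hs₀, Finset.mem_union_right _ hx⟩

/-- Combinatorial heart of Theorem 5.4: under the deficiency-`k` condition on `(I s)`,
for injective `ν` and pairwise disjoint compensating sets `B j` of cardinality `k`
disjoint from the range of `ν`, each family `fam ν B I m` (for `m ≥ 1`) admits an
injective system of distinct representatives. -/
theorem stmt_11 (k : ℕ) (I : ℕ → Finset ℕ)
    (hI : ∀ F : Finset ℕ, F.card ≤ (F.biUnion I).card + k)
    (ν : ℤ × ℕ → ℕ) (hν : Function.Injective ν)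
    (B : ℤ → Finset ℕ)
    (hBdisj : ∀ j j', j ≠ j' → Disjoint (B j) (B j'))
    (hBcard : ∀ j, (B j).card = k)
    (hBν : ∀ (j : ℤ) (x : ℤ × ℕ), ν x ∉ B j)
    (m : ℕ) (hm : 1 ≤ m) :
    ∃ t : (Fin m → ℤ) × ℕ → ℕ, Function.Injective t ∧
      ∀ lam : (Fin m → ℤ) × ℕ, t lam ∈ fam ν B I m lam := by
  induction m, hm using Nat.le_induction with
  | base =>
    choose t ht hmem using fun j => exists_injective_mem_image_union_of_deficiency hI
      (g := fun x => ν (j, x)) (fun x y h => (Prod.ext_iff.1 (hν h)).2) (hBcard j)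
      fun x => hBν j (j, x)
    refine ⟨fun lam => t (lam.1 0) lam.2, ?_, fun lam => ?_⟩
    · rintro ⟨u, s⟩ ⟨v, s'⟩ (h : t (u 0) s = t (v 0) s')
      have huv : u 0 = v 0 := by
        have h₁ := hmem (u 0) s
        have h₂ := hmem (v 0) s'
        rw [← h] at h₂
        rw [Finset.mem_union, Finset.mem_image] at h₁ h₂
        obtain ⟨a, -, ha⟩ | h₁ := h₁ <;> obtain ⟨b, -, hb⟩ | h₂ := h₂
        · exact congrArg Prod.fst (hν (ha.trans hb.symm))
        · exact absurd (ha ▸ h₂) (hBν _ _)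
        · exact absurd (hb ▸ h₁) (hBν _ _)
        · by_contra hne
          exact Finset.disjoint_left.1 (hBdisj _ _ hne) h₁ h₂
      rw [← huv] at h
      refine Prod.ext (funext fun i => ?_) (ht _ h)
      rw [Subsingleton.elim i 0]
      exact huv
    · exact Finset.union_subset_union_right Finset.subset_union_left (hmem (lam.1 0) lam.2)
  | succ m _ ih =>
    obtain ⟨t, ht, hmem⟩ := ih
    refine ⟨fun lam => ν (lam.1 0, t (fun i => lam.1 i.succ, lam.2)), ?_, fun lam =>
      Finset.mem_union_left _ (Finset.mem_image_of_mem _ (hmem _))⟩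
    rintro ⟨u, s⟩ ⟨v, s'⟩ h
    obtain ⟨h₀, h₁⟩ := Prod.ext_iff.1 (hν h)
    obtain ⟨hsucc, hs⟩ := Prod.ext_iff.1 (ht h₁)
    exact Prod.ext (funext (Fin.cases h₀ fun i => congrFun hsucc i)) hs
end
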